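/- arXiv:hep-th/9506089 — 2 statements merged into one kernel-verified Lean document; each statement's English description precedes it below -/
import Mathlib

section
/- Let p and p̄ be integers with p ≥ 1 and p̄ ≥ 1, let ħ > 0 be real, and let j be an integer with 2j < p̄ − 1. Then for every real λ > 0 the function λ ↦ J_j(λ) is differentiable at λ with derivative (p·λ^(p−1)/ħ) · J_{j−p̄}(λ); equivalently, (ħ/p)·λ^(1−p)·(d/dλ)J_j(λ) = J_{j−p̄}(λ). -/
open MeasureTheory Set

/-- The generating function `J_j(λ)` (at `t̄ = 0`) of the `(p, p̄)` family of
solutions of the Toda lattice hierarchy. -/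
noncomputable def J (p pb : ℤ) (hbar lam : ℝ) (j : ℤ) : ℝ :=
  ∫ μ in Ioi (0 : ℝ),
    μ ^ (((pb : ℝ) - 1) / 2 - (j : ℝ) - 1) *
      Real.exp (hbar⁻¹ * (lam ^ (p : ℝ) * μ ^ (pb : ℝ) -
        ((pb : ℝ) / ((p : ℝ) + (pb : ℝ))) * μ ^ ((p : ℝ) + (pb : ℝ))))

theorem exists_mul_rpow_sub_mul_rpow_le {A b P q : ℝ} (hA : 0 ≤ A) (hb : 0 < b) (hP : 0 < P)
    (hq : 0 < q) :
    ∃ C : ℝ, ∀ x : ℝ, 0 < x → A * x ^ q - b * x ^ (P + q) ≤ C + -(b / 2) * x ^ (P + q) := by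
  have hR : 0 ≤ 2 * A / b := by positivity
  refine ⟨A * ((2 * A / b) ^ P⁻¹) ^ q, fun x hx => ?_⟩
  have hxq : 0 < x ^ q := Real.rpow_pos_of_pos hx q
  have hxP : 0 < x ^ P := Real.rpow_pos_of_pos hx P
  rw [Real.rpow_add hx]
  rcases le_total (2 * A / b) (x ^ P) with h | h
  · have h1 : 2 * A ≤ x ^ P * b := (div_le_iff₀ hb).1 h
    have h2 : 0 ≤ A * ((2 * A / b) ^ P⁻¹) ^ q := by positivity
    nlinarith [mul_le_mul_of_nonneg_right h1 hxq.le]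
  · have h1 : x ≤ (2 * A / b) ^ P⁻¹ := (Real.le_rpow_inv_iff_of_pos hx.le hR hP).2 h
    have h2 : x ^ q ≤ ((2 * A / b) ^ P⁻¹) ^ q := Real.rpow_le_rpow hx.le h1 hq.le
    have h3 : 0 ≤ b / 2 * (x ^ P * x ^ q) := by positivity
    nlinarith [mul_le_mul_of_nonneg_left h2 hA]

theorem integrableOn_rpow_mul_exp_mul_rpow_sub {A b P q s : ℝ} (hA : 0 ≤ A) (hb : 0 < b)
    (hP : 0 < P) (hq : 0 < q) (hs : -1 < s) :
    IntegrableOn (fun x : ℝ => x ^ s * Real.exp (A * x ^ q - b * x ^ (P + q))) (Ioi 0) := by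
  obtain ⟨C, hC⟩ := exists_mul_rpow_sub_mul_rpow_le hA hb hP hq
  refine Integrable.mono' ((integrableOn_rpow_mul_exp_neg_mul_rpow hs (add_pos hP hq)
    (half_pos hb)).const_mul (Real.exp C)) (Measurable.aestronglyMeasurable (by fun_prop)) ?_
  filter_upwards [ae_restrict_mem measurableSet_Ioi] with x hx
  have hxs : 0 < x ^ s := Real.rpow_pos_of_pos hx s
  rw [Real.norm_of_nonneg (by positivity), mul_left_comm, ← Real.exp_add]
  exact mul_le_mul_of_nonneg_left (Real.exp_le_exp.2 (hC x hx)) hxs.le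

theorem stmt_1 (p pb : ℤ) (hp : 1 ≤ p) (hpb : 1 ≤ pb)
    (hbar : ℝ) (hhbar : 0 < hbar)
    (j : ℤ) (hj : 2 * j < pb - 1) :
    ∀ lam : ℝ, 0 < lam →
      HasDerivAt (fun l : ℝ => J p pb hbar l j)
        ((p : ℝ) * lam ^ ((p : ℝ) - 1) / hbar * J p pb hbar lam (j - pb)) lam := by
  intro lam hlam
  have hp' : (1 : ℝ) ≤ p := by exact_mod_cast hp
  have hpb' : (1 : ℝ) ≤ pb := by exact_mod_cast hpb
  have hj' : 2 * (j : ℝ) < pb - 1 := by exact_mod_cast hj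
  have hp0 : (0 : ℝ) < p := by linarith
  have hpb0 : (0 : ℝ) < pb := by linarith
  let G : ℤ → ℝ → ℝ → ℝ := fun i l μ => μ ^ (((pb : ℝ) - 1) / 2 - (i : ℝ) - 1) *
      Real.exp (hbar⁻¹ * (l ^ (p : ℝ) * μ ^ (pb : ℝ) -
        ((pb : ℝ) / ((p : ℝ) + (pb : ℝ))) * μ ^ ((p : ℝ) + (pb : ℝ))))
  have hG_meas (i : ℤ) (l : ℝ) : Measurable (G i l) := by fun_prop
  have hG_int (i : ℤ) (hi : 2 * (i : ℝ) < pb - 1) (l : ℝ) (hl : 0 < l) :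
      IntegrableOn (G i l) (Ioi 0) := by
    convert integrableOn_rpow_mul_exp_mul_rpow_sub (A := hbar⁻¹ * l ^ (p : ℝ))
      (b := hbar⁻¹ * ((pb : ℝ) / ((p : ℝ) + (pb : ℝ)))) (P := p) (q := pb)
      (s := ((pb : ℝ) - 1) / 2 - (i : ℝ) - 1) (by positivity) (by positivity) hp0 hpb0
      (by linarith) using 4
    ring
  have key := hasDerivAt_integral_of_dominated_loc_of_deriv_le
    (μ := volume.restrict (Ioi (0 : ℝ))) (F := G j)
    (F' := fun l μ => (p : ℝ) * l ^ ((p : ℝ) - 1) / hbar * G (j - pb) l μ)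
    (bound := fun μ => (p : ℝ) * (lam + 1) ^ ((p : ℝ) - 1) / hbar * G (j - pb) (lam + 1) μ)
    (x₀ := lam) (s := Ioo 0 (lam + 1)) (Ioo_mem_nhds hlam (by linarith))
    (.of_forall fun l => (hG_meas j l).aestronglyMeasurable) (hG_int j hj' lam hlam)
    ((hG_meas (j - pb) lam).const_mul _).aestronglyMeasurable ?_
    ((hG_int (j - pb) (by push_cast; linarith) (lam + 1) (by linarith)).const_mul _) ?_
  · have h := key.2
    rw [integral_const_mul] at h
    exact h
  · filter_upwards [ae_restrict_mem measurableSet_Ioi] with x (hx : 0 < x) l ⟨hl0, hl1⟩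
    have hlp : l ^ (p : ℝ) ≤ (lam + 1) ^ (p : ℝ) := Real.rpow_le_rpow hl0.le hl1.le hp0.le
    have hlp' : l ^ ((p : ℝ) - 1) ≤ (lam + 1) ^ ((p : ℝ) - 1) :=
      Real.rpow_le_rpow hl0.le hl1.le (by linarith)
    have hGnonneg : 0 ≤ G (j - pb) l x := by positivity
    have hGle : G (j - pb) l x ≤ G (j - pb) (lam + 1) x := by
      dsimp only [G]
      gcongr
    rw [Real.norm_of_nonneg (by positivity)]
    gcongr
  · filter_upwards [ae_restrict_mem measurableSet_Ioi] with x (hx : 0 < x) l ⟨hl0, hl1⟩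
    have h := (((((Real.hasDerivAt_rpow_const (p := (p : ℝ)) (.inl hl0.ne')).mul_const
      (x ^ (pb : ℝ))).sub_const ((pb : ℝ) / ((p : ℝ) + (pb : ℝ)) *
      x ^ ((p : ℝ) + (pb : ℝ)))).const_mul hbar⁻¹).exp).const_mul
      (x ^ (((pb : ℝ) - 1) / 2 - (j : ℝ) - 1))
    refine h.congr_deriv ?_
    have hexp : ((pb : ℝ) - 1) / 2 - ((j - pb : ℤ) : ℝ) - 1 =
        (((pb : ℝ) - 1) / 2 - (j : ℝ) - 1) + pb := by push_cast; ring
    dsimp only [G]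
    rw [hexp, Real.rpow_add hx (((pb : ℝ) - 1) / 2 - (j : ℝ) - 1)]
    ring
end

section
/- Let p and p̄ be integers with p ≥ 1 and p̄ ≥ 1, let ħ > 0 be real, and let j be an integer with 2j < p̄ − 1. Then for every real λ > 0, u_{j−p̄}(λ) = (ħ/p)·λ^(1−p)·(d/dλ)u_j(λ) − ħ·((p−1)/(2p))·λ^(−p)·u_j(λ) + λ^p̄ · u_j(λ), where d/dλ denotes the derivative at λ (which exists). -/
open MeasureTheory Set

/-- The prefactor `c(λ)`. -/
noncomputable def cpre (p pb : ℤ) (hbar lam : ℝ) : ℝ :=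
  lam ^ (((p : ℝ) - 1) / 2) *
    Real.exp (-(hbar⁻¹ * ((p : ℝ) / ((p : ℝ) + (pb : ℝ))) * lam ^ ((p : ℝ) + (pb : ℝ))))

/-- The full generating function `u_j(λ) = c(λ) · J_j(λ)`. -/
noncomputable def u (p pb : ℤ) (hbar : ℝ) (j : ℤ) (lam : ℝ) : ℝ :=
  cpre p pb hbar lam * J p pb hbar lam j

open Filter Topology

theorem integrableOn_rpow_mul_exp_mul_rpow_sub_rpow {a P Q κ C : ℝ} (ha : -1 < a) (hP : 0 < P)
    (hQ : 0 < Q) (hκ : 0 < κ) (hC : 0 < C) (y : ℝ) :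
    IntegrableOn (fun x : ℝ => x ^ a * Real.exp (κ * (y * x ^ Q - C * x ^ (P + Q))))
      (Ioi 0) := by
  set Y : ℝ := |y|
  set R : ℝ := (2 * Y / C) ^ P⁻¹ with hR
  have hY0 : 0 ≤ 2 * Y / C := by positivity
  have hdom := (integrableOn_rpow_mul_exp_neg_mul_rpow (p := P + Q) (s := a) (b := κ * (C / 2))
    ha (by positivity) (by positivity)).const_mul (Real.exp (κ * (Y * R ^ Q)))
  refine Integrable.mono' hdom (Measurable.aestronglyMeasurable (by fun_prop)) ?_
  refine (ae_restrict_iff' measurableSet_Ioi).2 (Eventually.of_forall fun x hx => ?_)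
  have hx0 : 0 < x := hx
  have hxQ : 0 < x ^ Q := Real.rpow_pos_of_pos hx0 Q
  have hxa : 0 < x ^ a := Real.rpow_pos_of_pos hx0 a
  have hle : Y * x ^ Q ≤ Y * R ^ Q + C / 2 * x ^ (P + Q) := by
    rcases le_total (2 * Y / C) (x ^ P) with h | h
    · have h1 : Y ≤ C / 2 * x ^ P := by
        rw [div_le_iff₀ hC] at h
        linarith
      have h2 := mul_le_mul_of_nonneg_right h1 hxQ.le
      have h3 : 0 ≤ Y * R ^ Q := by positivity
      rw [Real.rpow_add hx0]
      linarith
    · have h1 : x ≤ R := by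
        rw [hR, Real.le_rpow_inv_iff_of_pos hx0.le hY0 hP]
        exact h
      have h2 : x ^ Q ≤ R ^ Q := Real.rpow_le_rpow hx0.le h1 hQ.le
      have h3 : 0 ≤ C / 2 * x ^ (P + Q) := by positivity
      have h4 : Y * x ^ Q ≤ Y * R ^ Q := mul_le_mul_of_nonneg_left h2 (abs_nonneg y)
      linarith
  have hyY : y * x ^ Q ≤ Y * x ^ Q := mul_le_mul_of_nonneg_right (le_abs_self y) hxQ.le
  rw [Real.norm_of_nonneg (by positivity), mul_left_comm, ← Real.exp_add]
  refine mul_le_mul_of_nonneg_left (Real.exp_le_exp.2 ?_) hxa.le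
  have := mul_le_mul_of_nonneg_left (hyY.trans hle) hκ.le
  linarith

theorem hasDerivAt_integral_rpow_mul_exp_mul_rpow_sub_rpow {a P Q κ C : ℝ} (ha : -1 < a)
    (hP : 0 < P) (hQ : 0 < Q) (hκ : 0 < κ) (hC : 0 < C) (y : ℝ) :
    HasDerivAt
      (fun y : ℝ => ∫ x in Ioi (0 : ℝ), x ^ a * Real.exp (κ * (y * x ^ Q - C * x ^ (P + Q))))
      (κ * ∫ x in Ioi (0 : ℝ), x ^ (a + Q) * Real.exp (κ * (y * x ^ Q - C * x ^ (P + Q)))) y := by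
  rw [← integral_const_mul]
  refine (hasDerivAt_integral_of_dominated_loc_of_deriv_le (s := Iio (y + 1))
    (μ := volume.restrict (Ioi 0)) (x₀ := y)
    (F := fun y x => x ^ a * Real.exp (κ * (y * x ^ Q - C * x ^ (P + Q))))
    (bound := fun x => κ * (x ^ (a + Q) * Real.exp (κ * ((y + 1) * x ^ Q - C * x ^ (P + Q)))))
    (F' := fun y x => κ * (x ^ (a + Q) * Real.exp (κ * (y * x ^ Q - C * x ^ (P + Q)))))
    (Iio_mem_nhds (by linarith))
    (Eventually.of_forall fun z => Measurable.aestronglyMeasurable (by fun_prop))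
    (integrableOn_rpow_mul_exp_mul_rpow_sub_rpow ha hP hQ hκ hC y)
    (Measurable.aestronglyMeasurable (by fun_prop)) ?_
    ((integrableOn_rpow_mul_exp_mul_rpow_sub_rpow (by linarith) hP hQ hκ hC (y + 1)).const_mul κ)
    ?_).2
  · refine (ae_restrict_iff' measurableSet_Ioi).2 (Eventually.of_forall fun x hx z hz => ?_)
    have hx0 : 0 < x := hx
    have hz' : z ≤ y + 1 := le_of_lt hz
    rw [Real.norm_of_nonneg (by positivity)]
    gcongr
  · refine (ae_restrict_iff' measurableSet_Ioi).2 (Eventually.of_forall fun x hx z _ => ?_)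
    have h : HasDerivAt (fun z : ℝ => κ * (z * x ^ Q - C * x ^ (P + Q))) (κ * (1 * x ^ Q)) z :=
      (((hasDerivAt_id z).mul_const _).sub_const _).const_mul κ
    convert! h.exp.const_mul (x ^ a) using 1
    rw [Real.rpow_add hx]
    ring

theorem hasDerivAt_J {p pb : ℤ} (hp : 1 ≤ p) (hpb : 1 ≤ pb) {hbar : ℝ} (hhbar : 0 < hbar)
    {j : ℤ} (hj : 2 * j < pb - 1) {lam : ℝ} (hlam : 0 < lam) :
    HasDerivAt (fun l => J p pb hbar l j)
      (hbar⁻¹ * J p pb hbar lam (j - pb) * (p * lam ^ ((p : ℝ) - 1))) lam := by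
  have hP : (0 : ℝ) < p := by exact_mod_cast hp
  have hQ : (0 : ℝ) < pb := by exact_mod_cast hpb
  have hj' : 2 * (j : ℝ) < pb - 1 := by exact_mod_cast hj
  have h := (hasDerivAt_integral_rpow_mul_exp_mul_rpow_sub_rpow
    (a := ((pb : ℝ) - 1) / 2 - (j : ℝ) - 1) (P := p) (Q := pb) (κ := hbar⁻¹)
    (C := (pb : ℝ) / ((p : ℝ) + (pb : ℝ))) (by linarith) hP hQ (by positivity) (by positivity)
    (lam ^ (p : ℝ))).comp lam (Real.hasDerivAt_rpow_const (p := (p : ℝ)) (Or.inl hlam.ne'))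
  have he : ((pb : ℝ) - 1) / 2 - (j : ℝ) - 1 + pb
      = ((pb : ℝ) - 1) / 2 - ((j - pb : ℤ) : ℝ) - 1 := by
    push_cast
    ring
  rw [he] at h
  exact h

theorem hasDerivAt_cpre {p pb : ℤ} (hppb : (p : ℝ) + pb ≠ 0) (hbar : ℝ) {lam : ℝ}
    (hlam : 0 < lam) :
    HasDerivAt (cpre p pb hbar)
      (cpre p pb hbar lam *
        (((p : ℝ) - 1) / 2 * lam⁻¹ - hbar⁻¹ * p * (lam ^ (p : ℝ) * lam ^ (pb : ℝ) * lam⁻¹)))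
      lam := by
  have h1 := Real.hasDerivAt_rpow_const (x := lam) (p := ((p : ℝ) - 1) / 2) (Or.inl hlam.ne')
  have h2 := Real.hasDerivAt_rpow_const (x := lam) (p := (p : ℝ) + pb) (Or.inl hlam.ne')
  convert! h1.mul (h2.const_mul (hbar⁻¹ * ((p : ℝ) / ((p : ℝ) + (pb : ℝ))))).neg.exp using 1
  rw [Real.rpow_sub_one hlam.ne', Real.rpow_sub_one hlam.ne', cpre]
  simp only [Pi.neg_apply, Real.rpow_add hlam]
  field_simp
  ring

theorem stmt_2 (p pb : ℤ) (hp : 1 ≤ p) (hpb : 1 ≤ pb)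
    (hbar : ℝ) (hhbar : 0 < hbar)
    (j : ℤ) (hj : 2 * j < pb - 1) :
    ∀ lam : ℝ, 0 < lam →
      DifferentiableAt ℝ (u p pb hbar j) lam ∧
      u p pb hbar (j - pb) lam =
        hbar / (p : ℝ) * lam ^ (1 - (p : ℝ)) * deriv (u p pb hbar j) lam -
          hbar * (((p : ℝ) - 1) / (2 * (p : ℝ))) * lam ^ (-(p : ℝ)) * u p pb hbar j lam +
          lam ^ (pb : ℝ) * u p pb hbar j lam := by
  intro lam hlam
  have hP : (0 : ℝ) < p := by exact_mod_cast hp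
  have hQ : (0 : ℝ) < pb := by exact_mod_cast hpb
  have h : HasDerivAt (u p pb hbar j) _ lam :=
    (hasDerivAt_cpre (by positivity) hbar hlam).mul (hasDerivAt_J hp hpb hhbar hj hlam)
  refine ⟨h.differentiableAt, ?_⟩
  have hlp : lam ^ (p : ℝ) ≠ 0 := (Real.rpow_pos_of_pos hlam _).ne'
  rw [h.deriv, Real.rpow_sub hlam, Real.rpow_neg hlam.le, Real.rpow_sub_one hlam.ne',
    Real.rpow_one, u, u]
  field_simp
  ring
end
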